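/- Let 1<p,q<∞ and let σ, w be Radon measures on ℝ^N. The best constant 𝒮(σ,w,p,q) in the two-weight Stein inequality is comparable to the quadratic 𝒜_{p,q}-constant: [σ,w]_{p,q} ≤ 𝒮(σ,w,p,q) ≤ C(p,N)·[σ,w]_{p,q}, where the constant depends only on p and N (in particular one is finite iff the other is). -/

import Mathlib

open MeasureTheory ENNReal Set

noncomputable section

abbrev EucN (N : ℕ) := Fin N → ℝ

/-- The half-open cube `x + [0, 2^{-k})^N`. -/
def dyCube (N : ℕ) (k : ℤ) (x : EucN N) : Set (EucN N) :=
  {y | ∀ i, x i ≤ y i ∧ y i < x i + (2 : ℝ) ^ (-k)}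

/-- A dyadic lattice on `ℝ^N`: for every `k ∈ ℤ`, `gen k` is a partition of `ℝ^N` into
half-open cubes of side `2^{-k}`, and the generations are nested. -/
structure DyadicLattice (N : ℕ) where
  gen : ℤ → Set (Set (EucN N))
  cube_form : ∀ k Q, Q ∈ gen k → ∃ x, Q = dyCube N k x
  covers : ∀ k (y : EucN N), ∃ Q ∈ gen k, y ∈ Q
  pairwiseDisjoint : ∀ k, (gen k).PairwiseDisjoint id
  nested : ∀ k, ∀ Q ∈ gen (k + 1), ∃ R ∈ gen k, Q ⊆ R

namespace DyadicLattice
variable {N : ℕ}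
/-- The collection `𝒟` of all dyadic cubes. -/
def cubes (D : DyadicLattice N) : Set (Set (EucN N)) := ⋃ k, D.gen k
/-- `Q'` is a dyadic child of `Q`. -/
def child (D : DyadicLattice N) (Q Q' : Set (EucN N)) : Prop :=
  ∃ k, Q ∈ D.gen k ∧ Q' ∈ D.gen (k + 1) ∧ Q' ⊆ Q
/-- `R = Q^{(r)}` is the `r`-th dyadic ancestor of `Q`. -/
def anc (D : DyadicLattice N) (r : ℕ) (Q R : Set (EucN N)) : Prop :=
  ∃ k : ℤ, Q ∈ D.gen k ∧ R ∈ D.gen (k - r) ∧ Q ⊆ R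
end DyadicLattice

/-- `ℝ≥0∞`-valued indicator of a set. -/
def indE {N : ℕ} (Q : Set (EucN N)) (x : EucN N) : ℝ≥0∞ := Q.indicator 1 x

/-- `‖ (∑ i (f i)²)^{1/2} ‖_{L^p(μ)}` for a family of `ℝ≥0∞`-valued functions. -/
def sqNorm {N : ℕ} {ι : Type*} (μ : Measure (EucN N)) (p : ℝ)
    (f : ι → EucN N → ℝ≥0∞) : ℝ≥0∞ :=
  (∫⁻ x, (∑' i, f i x ^ 2) ^ (p / 2) ∂μ) ^ (1 / p)

/-- The quadratic `𝒜_{p,q}` constant `[σ,w]_{p,q}`: the least `C` such that for all real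
coefficients `(a_Q)_{Q ∈ 𝒟}`,
`‖(∑_Q (a_Q σ(Q)/|Q|)² 1_Q)^{1/2}‖_{L^q(w)} ≤ C ‖(∑_Q a_Q² 1_Q)^{1/2}‖_{L^p(σ)}`. -/
def sqA {N : ℕ} (D : DyadicLattice N) (σ w : Measure (EucN N)) (p q : ℝ) : ℝ≥0∞ :=
  sInf {C | ∀ a : Set (EucN N) → ℝ,
    sqNorm w q (fun Q : D.cubes => fun x =>
      (‖a (Q : Set (EucN N))‖₊ : ℝ≥0∞) * σ (Q : Set (EucN N)) / volume (Q : Set (EucN N))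
        * indE (Q : Set (EucN N)) x)
    ≤ C * sqNorm σ p (fun Q : D.cubes => fun x =>
      (‖a (Q : Set (EucN N))‖₊ : ℝ≥0∞) * indE (Q : Set (EucN N)) x)}

/-- The best constant `𝒮(σ,w,p,q)` in the two-weight Stein inequality: the least `C` such
that for every collection `(f_Q)_{Q ∈ 𝒟}` of locally `σ`-integrable functions,
`‖(∑_Q (∫_Q f_Q dσ / |Q|)² 1_Q)^{1/2}‖_{L^q(w)} ≤ C ‖(∑_Q f_Q² 1_Q)^{1/2}‖_{L^p(σ)}`. -/
def steinC {N : ℕ} (D : DyadicLattice N) (σ w : Measure (EucN N)) (p q : ℝ) : ℝ≥0∞ :=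
  sInf {C | ∀ f : Set (EucN N) → EucN N → ℝ,
    (∀ Q ∈ D.cubes, LocallyIntegrable (f Q) σ) →
    sqNorm w q (fun Q : D.cubes => fun x =>
      ENNReal.ofReal |∫ y in (Q : Set (EucN N)), f (Q : Set (EucN N)) y ∂σ|
        / volume (Q : Set (EucN N)) * indE (Q : Set (EucN N)) x)
    ≤ C * sqNorm σ p (fun Q : D.cubes => fun x =>
      (‖f (Q : Set (EucN N)) x‖₊ : ℝ≥0∞) * indE (Q : Set (EucN N)) x)}


/-- Absorption: if `X` is finite and `X ≤ K X^(1-a)` then `X^a ≤ K`. -/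
lemma ENNReal.rpow_le_of_le_mul_rpow_one_sub {X K : ℝ≥0∞} {a : ℝ} (hX : X ≠ ∞) (ha : 0 < a)
    (h : X ≤ K * X ^ (1 - a)) : X ^ a ≤ K := by
  rcases eq_or_ne X 0 with rfl | h0
  · simp [ENNReal.zero_rpow_of_pos ha]
  have h1 : X ^ a * X ^ (1 - a) = X := by
    rw [← ENNReal.rpow_add _ _ h0 hX]; simp
  have h2 : X ^ a * X ^ (1 - a) ≤ K * X ^ (1 - a) := by rwa [h1]
  exact (ENNReal.mul_le_mul_iff_left (by simp [ENNReal.rpow_eq_zero_iff, h0, hX])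
    (by simp [ENNReal.rpow_eq_top_iff, h0, hX])).1 h2

section Maximal

variable {α : Type*} [MeasurableSpace α] {μ : Measure α}

/-- A weak-type bound of `M` by `g` over its own superlevel sets implies
`‖M‖_r ≤ r/(r-1) ‖g‖_r`, as soon as `‖M‖_r` is finite. -/
lemma lintegral_rpow_le_of_mul_meas_lt_le {M g : α → ℝ≥0∞} {r : ℝ} (hr : 1 < r)
    (hM : Measurable M) (hMfin : ∀ x, M x ≠ ∞) (hg : Measurable g)
    (hw : ∀ t : ℝ≥0∞, t * μ {x | t < M x} ≤ ∫⁻ x in {x | t < M x}, g x ∂μ)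
    (hint : ∫⁻ x, M x ^ r ∂μ ≠ ∞) :
    ∫⁻ x, M x ^ r ∂μ ≤ (ENNReal.ofReal r / ENNReal.ofReal (r - 1)) ^ r * ∫⁻ x, g x ^ r ∂μ := by
  have hr0 : 0 < r := by linarith
  have hr1 : 0 < r - 1 := by linarith
  have hcake : ∀ (ν : Measure α) (s : ℝ), 0 < s → ∫⁻ x, M x ^ s ∂ν =
      ENNReal.ofReal s * ∫⁻ t in Ioi (0 : ℝ),
        ν {x | ENNReal.ofReal t < M x} * ENNReal.ofReal (t ^ (s - 1)) := by
    intro ν s hs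
    have h := lintegral_rpow_eq_lintegral_meas_lt_mul ν (f := fun x => (M x).toReal)
      (ae_of_all _ fun x => ENNReal.toReal_nonneg) hM.ennreal_toReal.aemeasurable hs
    have h1 : ∀ x, ENNReal.ofReal ((M x).toReal ^ s) = M x ^ s := fun x => by
      rw [← ENNReal.ofReal_rpow_of_nonneg ENNReal.toReal_nonneg hs.le,
        ENNReal.ofReal_toReal (hMfin x)]
    simp only [h1] at h
    rw [h]
    congr 1
    refine setLIntegral_congr_fun measurableSet_Ioi fun t ht => ?_
    have : {x | t < (M x).toReal} = {x | ENNReal.ofReal t < M x} := by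
      ext x
      exact (ENNReal.ofReal_lt_iff_lt_toReal (le_of_lt ht) (hMfin x)).symm
    simp only [this]
  have hkey : ENNReal.ofReal (r - 1) * ∫⁻ x, M x ^ r ∂μ ≤
      ENNReal.ofReal r * ∫⁻ x, M x ^ (r - 1) * g x ∂μ := by
    have hden : ∫⁻ x, M x ^ (r - 1) * g x ∂μ = ∫⁻ x, M x ^ (r - 1) ∂(μ.withDensity g) := by
      rw [lintegral_withDensity_eq_lintegral_mul _ hg (hM.pow_const _)]
      exact lintegral_congr fun x => mul_comm _ _
    rw [hden, hcake _ _ hr0, hcake _ _ hr1, mul_left_comm]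
    gcongr ENNReal.ofReal r * (ENNReal.ofReal (r - 1) * ?_)
    refine setLIntegral_mono' measurableSet_Ioi fun t (ht : 0 < t) => ?_
    have h1 : ENNReal.ofReal (t ^ (r - 1)) =
        ENNReal.ofReal t * ENNReal.ofReal (t ^ (r - 1 - 1)) := by
      rw [← ENNReal.ofReal_mul ht.le]
      congr 1
      rw [Real.rpow_sub_one ht.ne' (r - 1)]
      field_simp
    rw [h1, ← mul_assoc, mul_comm (μ _)]
    gcongr
    rw [withDensity_apply _ (measurableSet_lt measurable_const hM)]
    exact hw _
  have hc : r.HolderConjugate r.conjExponent := Real.HolderConjugate.conjExponent hr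
  have hholder := ENNReal.lintegral_mul_le_Lp_mul_Lq μ hc.symm
    (hM.pow_const (r - 1)).aemeasurable hg.aemeasurable
  have h2 : ∀ x, (M x ^ (r - 1)) ^ r.conjExponent = M x ^ r := fun x => by
    rw [← ENNReal.rpow_mul, hc.sub_one_mul_conj]
  simp only [Pi.mul_apply, h2] at hholder
  have h3 : 1 / r.conjExponent = 1 - 1 / r := by
    have := hc.inv_add_inv_eq_one
    simp only [one_div]; linarith
  rw [h3] at hholder
  set X := ∫⁻ x, M x ^ r ∂μ
  set Y := ∫⁻ x, g x ^ r ∂μ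
  have h4 : X ≤ (ENNReal.ofReal r / ENNReal.ofReal (r - 1) * Y ^ (1 / r)) * X ^ (1 - 1 / r) := by
    calc X ≤ (ENNReal.ofReal r * (X ^ (1 - 1 / r) * Y ^ (1 / r))) / ENNReal.ofReal (r - 1) := by
          rw [ENNReal.le_div_iff_mul_le (by simp [hr]) (by simp), mul_comm]
          exact hkey.trans (by gcongr)
      _ = _ := by simp only [div_eq_mul_inv]; ring
  have h5 := ENNReal.rpow_le_of_le_mul_rpow_one_sub hint (by positivity) h4
  have h6 := ENNReal.rpow_le_rpow h5 hr0.le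
  rwa [ENNReal.mul_rpow_of_nonneg _ _ hr0.le, ← ENNReal.rpow_mul, ← ENNReal.rpow_mul,
    one_div_mul_cancel hr0.ne', ENNReal.rpow_one, ENNReal.rpow_one] at h6

/-- For a laminar finite family of sets, an inequality between measures that holds on each member
holds on the union. -/
lemma mul_measure_biUnion_le_of_laminar {ν : Measure α} {t : ℝ≥0∞} (T : Finset (Set α))
    (hm : ∀ A ∈ T, MeasurableSet A)
    (hlam : ∀ A ∈ T, ∀ B ∈ T, A ⊆ B ∨ B ⊆ A ∨ Disjoint A B)
    (h : ∀ A ∈ T, t * μ A ≤ ν A) : t * μ (⋃ A ∈ T, A) ≤ ν (⋃ A ∈ T, A) := by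
  classical
  induction T using Finset.strongInduction with
  | H T ih =>
    rcases T.eq_empty_or_nonempty with rfl | hne
    · simp
    obtain ⟨Q, hQ, hmax⟩ := T.exists_maximal hne
    let T' := T.filter fun A => Disjoint Q A
    have hsub : T' ⊆ T := Finset.filter_subset _ _
    by_cases hQe : Q = ∅
    · have : (⋃ A ∈ T, A) = ∅ := by
        simp only [iUnion_eq_empty]
        intro A hA
        have := hmax hA (by simp [hQe])
        exact Set.subset_empty_iff.1 (hQe ▸ this)
      simp [this]
    have hss : T' ⊂ T := by
      refine Finset.ssubset_iff_subset_ne.2 ⟨hsub, fun he => hQe ?_⟩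
      have : Q ∈ T' := he ▸ hQ
      exact disjoint_self.1 (Finset.mem_filter.1 this).2
    have hU : (⋃ A ∈ T, A) = Q ∪ ⋃ A ∈ T', A := by
      apply Subset.antisymm
      · refine iUnion₂_subset fun A hA => ?_
        rcases hlam Q hQ A hA with h1 | h1 | h1
        · exact (hmax hA h1).trans subset_union_left
        · exact h1.trans subset_union_left
        · exact (subset_biUnion_of_mem (u := fun A => A)
            (Finset.mem_coe.2 (Finset.mem_filter.2 ⟨hA, h1⟩))).trans subset_union_right
      · exact union_subset (subset_biUnion_of_mem (u := fun A => A) (Finset.mem_coe.2 hQ))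
          (biUnion_subset_biUnion_left hsub)
    have hd : Disjoint Q (⋃ A ∈ T', A) :=
      disjoint_iUnion₂_right.2 fun A hA => (Finset.mem_filter.1 hA).2
    have hm' : MeasurableSet (⋃ A ∈ T', A) :=
      T'.measurableSet_biUnion fun A hA => hm A (hsub hA)
    rw [hU, measure_union hd hm', measure_union hd hm', mul_add]
    exact add_le_add (h Q hQ) (ih T' hss (fun A hA => hm A (hsub hA))
      (fun A hA B hB => hlam A (hsub hA) B (hsub hB)) fun A hA => h A (hsub hA))

/-- The averaging operator `g ↦ ⟨g⟩_E 1_E`. -/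
def avgOn (μ : Measure α) (E : Set α) (g : α → ℝ≥0∞) : α → ℝ≥0∞ :=
  E.indicator fun _ => ⨍⁻ y in E, g y ∂μ

lemma measurable_avgOn {E : Set α} (hE : MeasurableSet E) (g : α → ℝ≥0∞) :
    Measurable (avgOn μ E g) := measurable_const.indicator hE

lemma avgOn_of_mem {E : Set α} {x : α} (hx : x ∈ E) (g : α → ℝ≥0∞) :
    avgOn μ E g x = ⨍⁻ y in E, g y ∂μ := indicator_of_mem hx _

lemma avgOn_of_notMem {E : Set α} {x : α} (hx : x ∉ E) (g : α → ℝ≥0∞) :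
    avgOn μ E g x = 0 := indicator_of_notMem hx _

lemma avgOn_le (E : Set α) (g : α → ℝ≥0∞) (x : α) : avgOn μ E g x ≤ ⨍⁻ y in E, g y ∂μ :=
  indicator_le_self' (fun _ _ => zero_le) x

lemma lintegral_mul_avgOn {E : Set α} (hE : MeasurableSet E) {h : α → ℝ≥0∞}
    (hh : AEMeasurable h μ) (g : α → ℝ≥0∞) :
    ∫⁻ x, h x * avgOn μ E g x ∂μ = (∫⁻ x in E, h x ∂μ) * ⨍⁻ y in E, g y ∂μ := by
  rw [← lintegral_mul_const'' _ hh.restrict, ← lintegral_indicator hE]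
  refine lintegral_congr fun x => ?_
  by_cases hx : x ∈ E <;> simp [avgOn, hx]

/-- The averaging operator is self-adjoint. -/
lemma lintegral_mul_avgOn_comm {E : Set α} (hE : MeasurableSet E) {g h : α → ℝ≥0∞}
    (hh : AEMeasurable h μ) (hg : AEMeasurable g μ) :
    ∫⁻ x, h x * avgOn μ E g x ∂μ = ∫⁻ x, g x * avgOn μ E h x ∂μ := by
  rw [lintegral_mul_avgOn hE hh, lintegral_mul_avgOn hE hg, setLAverage_eq, setLAverage_eq]
  simp only [div_eq_mul_inv]; ring

lemma avgOn_sq_le {E : Set α} {g : α → ℝ≥0∞} (hg : AEMeasurable g μ) (hE : μ E ≠ ∞) (x : α) :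
    avgOn μ E g x ^ 2 ≤ avgOn μ E (fun y => g y ^ 2) x := by
  by_cases hx : x ∈ E
  swap
  · simp [avgOn, hx]
  rw [avgOn_of_mem hx, avgOn_of_mem hx, setLAverage_eq, setLAverage_eq]
  rcases eq_or_ne (μ E) 0 with h0 | h0
  · simp [Measure.restrict_eq_zero.2 h0]
  have h := ENNReal.lintegral_mul_le_Lp_mul_Lq (μ.restrict E) Real.HolderConjugate.two_two
    hg.restrict (aemeasurable_const (b := (1 : ℝ≥0∞)))
  simp only [Pi.mul_apply, mul_one, lintegral_const, Measure.restrict_apply_univ,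
    ENNReal.rpow_two] at h
  have h2 := ENNReal.rpow_le_rpow h (z := 2) (by norm_num)
  rw [ENNReal.mul_rpow_of_nonneg _ _ (by norm_num), ← ENNReal.rpow_mul, ← ENNReal.rpow_mul] at h2
  norm_num at h2
  rw [ENNReal.div_eq_inv_mul, mul_pow, ENNReal.div_eq_inv_mul]
  calc (μ E)⁻¹ ^ 2 * (∫⁻ x in E, g x ∂μ) ^ 2
      ≤ (μ E)⁻¹ ^ 2 * ((∫⁻ x in E, g x ^ 2 ∂μ) * μ E) := by gcongr
    _ = ((μ E)⁻¹ * μ E) * ((μ E)⁻¹ * ∫⁻ x in E, g x ^ 2 ∂μ) := by ring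
    _ = _ := by rw [ENNReal.inv_mul_cancel h0 hE, one_mul]

lemma setLAverage_le_of_le {E : Set α} {g : α → ℝ≥0∞} {c : ℝ≥0∞} (hg : ∀ x, g x ≤ c) :
    ⨍⁻ y in E, g y ∂μ ≤ c := by
  rw [setLAverage_eq]
  refine ENNReal.div_le_of_le_mul ?_
  calc ∫⁻ x in E, g x ∂μ ≤ ∫⁻ _ in E, c ∂μ := lintegral_mono fun x => hg x
    _ = c * μ E := by simp

lemma lintegral_rpow_ne_top_of_le {E : Set α} (hE : MeasurableSet E) (hEfin : μ E ≠ ∞)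
    {h : α → ℝ≥0∞} {c : ℝ≥0∞} (hc : c ≠ ∞) (hle : ∀ x, h x ≤ c) (hz : ∀ x ∉ E, h x = 0)
    {r : ℝ} (hr : 0 < r) : ∫⁻ x, h x ^ r ∂μ ≠ ∞ := by
  have h1 : ∫⁻ x, h x ^ r ∂μ ≤ ∫⁻ x, E.indicator (fun _ => c ^ r) x ∂μ := by
    refine lintegral_mono fun x => ?_
    by_cases hx : x ∈ E
    · simpa [hx] using ENNReal.rpow_le_rpow (hle x) hr.le
    · simp [hx, hz x hx, hr]
  refine ne_top_of_le_ne_top ?_ h1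
  rw [lintegral_indicator_const hE]
  exact ENNReal.mul_ne_top (ENNReal.rpow_ne_top_of_nonneg hr.le hc) hEfin

variable {ι : Type*} {Q : ι → Set α} {s : Finset ι}

lemma lintegral_sum_mul {g h : ι → α → ℝ≥0∞} (hg : ∀ i ∈ s, AEMeasurable (g i) μ)
    (hh : ∀ i ∈ s, AEMeasurable (h i) μ) :
    ∫⁻ x, ∑ i ∈ s, g i x * h i x ∂μ = ∑ i ∈ s, ∫⁻ x, g i x * h i x ∂μ :=
  lintegral_finsetSum' _ fun i hi => (hg i hi).mul (hh i hi)

/-- The maximal inequality in `L^r` for a finite laminar family of sets. -/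
lemma lintegral_iSup_avgOn_rpow_le {r : ℝ} (hr : 1 < r) (hQ : ∀ i ∈ s, MeasurableSet (Q i))
    (hfin : ∀ i ∈ s, μ (Q i) ≠ ∞)
    (hlam : ∀ i ∈ s, ∀ j ∈ s, Q i ⊆ Q j ∨ Q j ⊆ Q i ∨ Disjoint (Q i) (Q j))
    {g : α → ℝ≥0∞} (hg : Measurable g) (hgfin : ∀ i ∈ s, ⨍⁻ y in Q i, g y ∂μ ≠ ∞) :
    ∫⁻ x, (⨆ i ∈ s, avgOn μ (Q i) g x) ^ r ∂μ ≤
      (ENNReal.ofReal r / ENNReal.ofReal (r - 1)) ^ r * ∫⁻ x, g x ^ r ∂μ := by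
  classical
  have hle : ∀ x, ⨆ i ∈ s, avgOn μ (Q i) g x ≤ ∑ i ∈ s, ⨍⁻ y in Q i, g y ∂μ := fun x =>
    iSup₂_le fun i hi => (avgOn_le _ _ _).trans
      (Finset.single_le_sum (f := fun i => ⨍⁻ y in Q i, g y ∂μ) (fun _ _ => zero_le) hi)
  have hc : ∑ i ∈ s, ⨍⁻ y in Q i, g y ∂μ ≠ ∞ := ENNReal.sum_ne_top.2 hgfin
  have hM : Measurable fun x => ⨆ i ∈ s, avgOn μ (Q i) g x :=
    Measurable.biSup _ s.countable_toSet fun i hi => measurable_avgOn (hQ i hi) g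
  refine lintegral_rpow_le_of_mul_meas_lt_le hr hM (fun x => ne_top_of_le_ne_top hc (hle x)) hg
    (fun t => ?_) ?_
  · have hset : {x | t < ⨆ i ∈ s, avgOn μ (Q i) g x} =
        ⋃ A ∈ (s.filter fun i => t < ⨍⁻ y in Q i, g y ∂μ).image Q, A := by
      ext x
      simp only [mem_ofPred_eq, lt_iSup_iff, Finset.mem_image, Finset.mem_filter, mem_iUnion,
        exists_prop, exists_exists_and_eq_and]
      refine exists_congr fun i => ?_
      by_cases hx : x ∈ Q i <;> simp [avgOn, hx]
    rw [← withDensity_apply _ (measurableSet_lt measurable_const hM), hset]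
    refine mul_measure_biUnion_le_of_laminar _ ?_ ?_ ?_
    · simp only [Finset.forall_mem_image, Finset.mem_filter]
      exact fun i hi => hQ i hi.1
    · simp only [Finset.forall_mem_image, Finset.mem_filter]
      exact fun i hi j hj => hlam i hi.1 j hj.1
    · simp only [Finset.forall_mem_image, Finset.mem_filter]
      intro i hi
      rw [withDensity_apply _ (hQ i hi.1)]
      refine ENNReal.mul_le_of_le_div ?_
      rw [← setLAverage_eq]
      exact hi.2.le
  · refine lintegral_rpow_ne_top_of_le (s.measurableSet_biUnion hQ)
      ((measure_biUnion_lt_top s.finite_toSet fun i hi => (hfin i hi).lt_top).ne) hc hle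
      (fun x hx => ?_) (by linarith)
    simp only [mem_iUnion, not_exists] at hx
    simp only [ENNReal.iSup_eq_zero]
    exact fun i hi => avgOn_of_notMem (hx i hi) g

section SquareFunction

variable {f : ι → α → ℝ≥0∞}

lemma measurable_sum_avgOn_sq (hQ : ∀ i ∈ s, MeasurableSet (Q i)) :
    Measurable fun x => ∑ i ∈ s, avgOn μ (Q i) (f i) x ^ 2 :=
  Finset.measurable_sum _ fun i hi => (measurable_avgOn (hQ i hi) _).pow_const 2

lemma sum_avgOn_sq_le (x : α) :
    ∑ i ∈ s, avgOn μ (Q i) (f i) x ^ 2 ≤ ∑ i ∈ s, (⨍⁻ y in Q i, f i y ∂μ) ^ 2 :=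
  Finset.sum_le_sum fun _ _ => pow_le_pow_left' (avgOn_le _ _ _) 2

lemma sum_setLAverage_sq_ne_top (hf : ∀ i ∈ s, ⨍⁻ y in Q i, f i y ∂μ ≠ ∞) :
    ∑ i ∈ s, (⨍⁻ y in Q i, f i y ∂μ) ^ 2 ≠ ∞ :=
  ENNReal.sum_ne_top.2 fun i hi => ENNReal.pow_ne_top (hf i hi)

lemma lintegral_sum_avgOn_sq_rpow_ne_top (hQ : ∀ i ∈ s, MeasurableSet (Q i))
    (hfin : ∀ i ∈ s, μ (Q i) ≠ ∞) (hf : ∀ i ∈ s, ⨍⁻ y in Q i, f i y ∂μ ≠ ∞) {r : ℝ}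
    (hr : 0 < r) : ∫⁻ x, (∑ i ∈ s, avgOn μ (Q i) (f i) x ^ 2) ^ r ∂μ ≠ ∞ := by
  refine lintegral_rpow_ne_top_of_le (s.measurableSet_biUnion hQ)
    ((measure_biUnion_lt_top s.finite_toSet fun i hi => (hfin i hi).lt_top).ne)
    (sum_setLAverage_sq_ne_top hf) sum_avgOn_sq_le (fun x hx => ?_) hr
  simp only [mem_iUnion, not_exists] at hx
  exact Finset.sum_eq_zero fun i hi => by rw [avgOn_of_notMem (hx i hi)]; simp

/-- Testing the square of the averages against a weight `V` moves the averages onto `V`. -/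
lemma lintegral_sum_avgOn_sq_mul_le (hQ : ∀ i ∈ s, MeasurableSet (Q i))
    (hfin : ∀ i ∈ s, μ (Q i) ≠ ∞) (hf : ∀ i ∈ s, AEMeasurable (f i) μ)
    {V : α → ℝ≥0∞} (hV : Measurable V) :
    ∫⁻ x, (∑ i ∈ s, avgOn μ (Q i) (f i) x ^ 2) * V x ∂μ ≤
      ∫⁻ x, (∑ i ∈ s, f i x ^ 2) * ⨆ i ∈ s, avgOn μ (Q i) V x ∂μ := by
  calc ∫⁻ x, (∑ i ∈ s, avgOn μ (Q i) (f i) x ^ 2) * V x ∂μ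
      = ∑ i ∈ s, ∫⁻ x, V x * avgOn μ (Q i) (f i) x ^ 2 ∂μ := by
        rw [← lintegral_sum_mul (fun _ _ => hV.aemeasurable) fun i hi =>
          ((measurable_avgOn (hQ i hi) _).pow_const 2).aemeasurable]
        exact lintegral_congr fun x => by rw [Finset.sum_mul]; simp only [mul_comm]
    _ ≤ ∑ i ∈ s, ∫⁻ x, V x * avgOn μ (Q i) (fun y => f i y ^ 2) x ∂μ := by
        gcongr with i hi x
        exact avgOn_sq_le (hf i hi) (hfin i hi) x
    _ = ∑ i ∈ s, ∫⁻ x, f i x ^ 2 * avgOn μ (Q i) V x ∂μ :=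
        Finset.sum_congr rfl fun i hi =>
          lintegral_mul_avgOn_comm (hQ i hi) hV.aemeasurable ((hf i hi).pow_const 2)
    _ = ∫⁻ x, ∑ i ∈ s, f i x ^ 2 * avgOn μ (Q i) V x ∂μ :=
        (lintegral_sum_mul (fun i hi => (hf i hi).pow_const 2)
          fun i hi => (measurable_avgOn (hQ i hi) _).aemeasurable).symm
    _ ≤ _ := by
        refine lintegral_mono fun x => ?_
        simp only [Finset.sum_mul]
        gcongr with i hi
        exact le_iSup₂ (f := fun i _ => avgOn μ (Q i) V x) i hi

/-- Stein's inequality in `L^2`. -/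
lemma lintegral_sum_avgOn_sq_le (hQ : ∀ i ∈ s, MeasurableSet (Q i))
    (hfin : ∀ i ∈ s, μ (Q i) ≠ ∞) (hf : ∀ i ∈ s, AEMeasurable (f i) μ) :
    ∫⁻ x, ∑ i ∈ s, avgOn μ (Q i) (f i) x ^ 2 ∂μ ≤ ∫⁻ x, ∑ i ∈ s, f i x ^ 2 ∂μ := by
  have h := lintegral_sum_avgOn_sq_mul_le hQ hfin hf (measurable_const (a := (1 : ℝ≥0∞)))
  simp only [mul_one] at h
  refine h.trans (lintegral_mono fun x => mul_le_of_le_one_right' ?_)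
  exact iSup₂_le fun i _ => (avgOn_le _ _ _).trans (setLAverage_le_of_le fun _ => le_rfl)

/-- The constant in Stein's inequality in `L^{2r}`, `r > 1`. -/
def steinConstLarge (r : ℝ) : ℝ≥0∞ :=
  (((ENNReal.ofReal r.conjExponent / ENNReal.ofReal (r.conjExponent - 1)) ^ r.conjExponent) ^
    (1 / r.conjExponent)) ^ r

lemma steinConstLarge_ne_top {r : ℝ} (hr : 1 < r) : steinConstLarge r ≠ ∞ := by
  have hc := (Real.HolderConjugate.conjExponent hr).symm
  refine ENNReal.rpow_ne_top_of_nonneg (by linarith) (ENNReal.rpow_ne_top_of_nonneg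
    (one_div_nonneg.2 hc.nonneg) (ENNReal.rpow_ne_top_of_nonneg hc.nonneg
      (ENNReal.div_ne_top ENNReal.ofReal_ne_top ?_)))
  simp [hc.lt]

/-- Stein's inequality in `L^{2r}`, `r > 1`. -/
lemma lintegral_sum_avgOn_sq_rpow_le {r : ℝ} (hr : 1 < r) (hQ : ∀ i ∈ s, MeasurableSet (Q i))
    (hfin : ∀ i ∈ s, μ (Q i) ≠ ∞)
    (hlam : ∀ i ∈ s, ∀ j ∈ s, Q i ⊆ Q j ∨ Q j ⊆ Q i ∨ Disjoint (Q i) (Q j))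
    (hf : ∀ i ∈ s, AEMeasurable (f i) μ) (hffin : ∀ i ∈ s, ⨍⁻ y in Q i, f i y ∂μ ≠ ∞) :
    ∫⁻ x, (∑ i ∈ s, avgOn μ (Q i) (f i) x ^ 2) ^ r ∂μ ≤
      steinConstLarge r * ∫⁻ x, (∑ i ∈ s, f i x ^ 2) ^ r ∂μ := by
  have hr0 : 0 < r := by linarith
  have hc := Real.HolderConjugate.conjExponent hr
  unfold steinConstLarge
  set r' := r.conjExponent
  set U : α → ℝ≥0∞ := fun x => ∑ i ∈ s, avgOn μ (Q i) (f i) x ^ 2 with hU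
  have hUm : Measurable U := measurable_sum_avgOn_sq hQ
  have hUle : ∀ x, U x ^ (r - 1) ≤ (∑ i ∈ s, (⨍⁻ y in Q i, f i y ∂μ) ^ 2) ^ (r - 1) :=
    fun x => ENNReal.rpow_le_rpow (sum_avgOn_sq_le x) (by linarith)
  have hVfin : ∀ i ∈ s, ⨍⁻ y in Q i, U y ^ (r - 1) ∂μ ≠ ∞ := fun i _ =>
    ne_top_of_le_ne_top (ENNReal.rpow_ne_top_of_nonneg (by linarith)
      (sum_setLAverage_sq_ne_top hffin)) (setLAverage_le_of_le hUle)
  have hmax := lintegral_iSup_avgOn_rpow_le hc.symm.lt hQ hfin hlam (hUm.pow_const (r - 1)) hVfin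
  have h2 : ∀ x, (U x ^ (r - 1)) ^ r' = U x ^ r := fun x => by
    rw [← ENNReal.rpow_mul, hc.sub_one_mul_conj]
  simp only [h2] at hmax
  have hsplit : ∀ x, U x ^ r = U x * U x ^ (r - 1) := fun x => by
    conv_lhs => rw [show r = 1 + (r - 1) by ring]
    rw [ENNReal.rpow_add_of_nonneg _ _ zero_le_one (by linarith), ENNReal.rpow_one]
  have htest := lintegral_sum_avgOn_sq_mul_le hQ hfin hf (hUm.pow_const (r - 1))
  have hM : Measurable fun x => ⨆ i ∈ s, avgOn μ (Q i) (fun x => U x ^ (r - 1)) x :=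
    Measurable.biSup _ s.countable_toSet fun i hi => measurable_avgOn (hQ i hi) _
  have hG : AEMeasurable (fun x => ∑ i ∈ s, f i x ^ 2) μ :=
    Finset.aemeasurable_fun_sum _ fun i hi => (hf i hi).pow_const 2
  have hholder := ENNReal.lintegral_mul_le_Lp_mul_Lq μ hc hG hM.aemeasurable
  simp only [Pi.mul_apply] at hholder
  have hXfin := lintegral_sum_avgOn_sq_rpow_ne_top hQ hfin hffin hr0
  change ∫⁻ x, U x ^ r ∂μ ≠ ∞ at hXfin
  set c := (ENNReal.ofReal r' / ENNReal.ofReal (r' - 1)) ^ r'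
  set Y := ∫⁻ x, (∑ i ∈ s, f i x ^ 2) ^ r ∂μ
  have h3 : 1 / r' = 1 - 1 / r := by
    have := hc.inv_add_inv_eq_one
    simp only [one_div]; linarith
  have hX : ∫⁻ x, U x ^ r ∂μ ≤
      (Y ^ (1 / r) * c ^ (1 / r')) * (∫⁻ x, U x ^ r ∂μ) ^ (1 - 1 / r) := by
    calc ∫⁻ x, U x ^ r ∂μ = ∫⁻ x, U x * U x ^ (r - 1) ∂μ := lintegral_congr hsplit
      _ ≤ _ := htest
      _ ≤ _ := hholder
      _ ≤ Y ^ (1 / r) * (c * ∫⁻ x, U x ^ r ∂μ) ^ (1 / r') := by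
          gcongr
          exact hc.symm.one_div_nonneg
      _ = _ := by
          rw [ENNReal.mul_rpow_of_nonneg _ _ hc.symm.one_div_nonneg, ← h3, mul_assoc]
  have h5 := ENNReal.rpow_le_of_le_mul_rpow_one_sub hXfin (by positivity) hX
  have h6 := ENNReal.rpow_le_rpow h5 hr0.le
  rw [ENNReal.mul_rpow_of_nonneg _ _ hr0.le, ← ENNReal.rpow_mul, ← ENNReal.rpow_mul,
    one_div_mul_cancel hr0.ne', ENNReal.rpow_one, ENNReal.rpow_one] at h6
  rwa [mul_comm]

/-- Stein's inequality in `L^p`, `1 < p < 2`, follows by duality from the one in the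
conjugate exponent. -/
lemma lintegral_sum_avgOn_sq_rpow_le_of_conj {p p' : ℝ} {K : ℝ≥0∞} (hc : p.HolderConjugate p')
    (hQ : ∀ i ∈ s, MeasurableSet (Q i)) (hfin : ∀ i ∈ s, μ (Q i) ≠ ∞)
    (hK : ∀ g : ι → α → ℝ≥0∞, (∀ i ∈ s, Measurable (g i)) →
      (∀ i ∈ s, ⨍⁻ y in Q i, g i y ∂μ ≠ ∞) →
      ∫⁻ x, (∑ i ∈ s, avgOn μ (Q i) (g i) x ^ 2) ^ (p' / 2) ∂μ ≤
        K * ∫⁻ x, (∑ i ∈ s, g i x ^ 2) ^ (p' / 2) ∂μ)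
    (hf : ∀ i ∈ s, AEMeasurable (f i) μ) (hffin : ∀ i ∈ s, ⨍⁻ y in Q i, f i y ∂μ ≠ ∞) :
    ∫⁻ x, (∑ i ∈ s, avgOn μ (Q i) (f i) x ^ 2) ^ (p / 2) ∂μ ≤
      (K ^ (1 / p')) ^ p * ∫⁻ x, (∑ i ∈ s, f i x ^ 2) ^ (p / 2) ∂μ := by
  have hp1 : 0 < p - 1 := hc.sub_one_pos
  have hp0 : 0 < p := hc.pos
  set A : ι → α → ℝ≥0∞ := fun i => avgOn μ (Q i) (f i) with hA
  have hAm : ∀ i ∈ s, Measurable (A i) := fun i hi => measurable_avgOn (hQ i hi) _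
  set U : α → ℝ≥0∞ := fun x => ∑ i ∈ s, A i x ^ 2 with hU
  have hUm : Measurable U := measurable_sum_avgOn_sq hQ
  have hUc : ∀ x, U x ≤ ∑ i ∈ s, (⨍⁻ y in Q i, f i y ∂μ) ^ 2 := sum_avgOn_sq_le
  have hcfin := sum_setLAverage_sq_ne_top hffin
  have hUfin : ∀ x, U x ≠ ∞ := fun x => ne_top_of_le_ne_top hcfin (hUc x)
  set g : ι → α → ℝ≥0∞ := fun i x => A i x * U x ^ (p / 2 - 1) with hg
  have hgm : ∀ i ∈ s, Measurable (g i) := fun i hi => (hAm i hi).mul (hUm.pow_const _)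
  have hpair : ∀ x, U x ^ (p / 2) = ∑ i ∈ s, A i x * g i x := fun x => by
    have : ∑ i ∈ s, A i x * g i x = U x * U x ^ (p / 2 - 1) := by
      rw [hU, Finset.sum_mul]
      exact Finset.sum_congr rfl fun i _ => by simp only [hg]; ring
    rw [this]
    rcases eq_or_ne (U x) 0 with h0 | h0
    · simp [h0, hp0]
    · conv_lhs => rw [show p / 2 = 1 + (p / 2 - 1) by ring]
      rw [ENNReal.rpow_add _ _ h0 (hUfin x), ENNReal.rpow_one]
  have hgsq : ∀ x, ∑ i ∈ s, g i x ^ 2 = U x ^ (p - 1) := fun x => by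
    have : ∑ i ∈ s, g i x ^ 2 = U x * (U x ^ (p / 2 - 1)) ^ 2 := by
      rw [hU, Finset.sum_mul]
      exact Finset.sum_congr rfl fun i _ => by simp only [hg]; ring
    rw [this]
    rcases eq_or_ne (U x) 0 with h0 | h0
    · simp [h0, hp1]
    · rw [← ENNReal.rpow_natCast, ← ENNReal.rpow_mul]
      conv_rhs => rw [show p - 1 = 1 + (p / 2 - 1) * ((2 : ℕ) : ℝ) by push_cast; ring]
      rw [ENNReal.rpow_add _ _ h0 (hUfin x), ENNReal.rpow_one]
  have hgfin : ∀ i ∈ s, ⨍⁻ y in Q i, g i y ∂μ ≠ ∞ := by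
    intro i hi
    refine ne_top_of_le_ne_top (b := ((∑ i ∈ s, (⨍⁻ y in Q i, f i y ∂μ) ^ 2) ^ (p - 1)) ^
      (1 / 2 : ℝ)) ?_ (setLAverage_le_of_le fun x => ?_)
    · exact ENNReal.rpow_ne_top_of_nonneg (by norm_num)
        (ENNReal.rpow_ne_top_of_nonneg hp1.le hcfin)
    · have h1 : g i x ^ 2 ≤ (∑ i ∈ s, (⨍⁻ y in Q i, f i y ∂μ) ^ 2) ^ (p - 1) := by
        calc g i x ^ 2 ≤ ∑ i ∈ s, g i x ^ 2 :=
              Finset.single_le_sum (f := fun i => g i x ^ 2) (fun _ _ => zero_le) hi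
          _ = U x ^ (p - 1) := hgsq x
          _ ≤ _ := ENNReal.rpow_le_rpow (hUc x) hp1.le
      rw [one_div, ENNReal.le_rpow_inv_iff (by norm_num)]
      simpa using h1
  have hKg := hK g hgm hgfin
  have h2 : ∀ x, (∑ i ∈ s, g i x ^ 2) ^ (p' / 2) = U x ^ (p / 2) := fun x => by
    rw [hgsq, ← ENNReal.rpow_mul, ← mul_div_assoc, hc.sub_one_mul_conj]
  simp only [h2] at hKg
  have hXfin : ∫⁻ x, U x ^ (p / 2) ∂μ ≠ ∞ :=
    lintegral_sum_avgOn_sq_rpow_ne_top hQ hfin hffin (by positivity)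
  have hsqrt : ∀ (h : ι → α → ℝ≥0∞) (q : ℝ) (x : α),
      ((∑ i ∈ s, h i x ^ 2) ^ (1 / 2 : ℝ)) ^ q = (∑ i ∈ s, h i x ^ 2) ^ (q / 2) := by
    intro h q x
    rw [← ENNReal.rpow_mul]; congr 1; ring
  have hF : AEMeasurable (fun x => (∑ i ∈ s, f i x ^ 2) ^ (1 / 2 : ℝ)) μ :=
    (Finset.aemeasurable_fun_sum _ fun i hi => (hf i hi).pow_const 2).pow_const _
  have hTg : Measurable fun x => (∑ i ∈ s, avgOn μ (Q i) (g i) x ^ 2) ^ (1 / 2 : ℝ) :=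
    (measurable_sum_avgOn_sq hQ).pow_const _
  have hholder := ENNReal.lintegral_mul_le_Lp_mul_Lq μ hc hF hTg.aemeasurable
  simp only [Pi.mul_apply, hsqrt] at hholder
  set Y := ∫⁻ x, (∑ i ∈ s, f i x ^ 2) ^ (p / 2) ∂μ
  have h3 : 1 / p' = 1 - 1 / p := by
    have := hc.inv_add_inv_eq_one
    simp only [one_div]; linarith
  have hX : ∫⁻ x, U x ^ (p / 2) ∂μ ≤
      (Y ^ (1 / p) * K ^ (1 / p')) * (∫⁻ x, U x ^ (p / 2) ∂μ) ^ (1 - 1 / p) := by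
    calc ∫⁻ x, U x ^ (p / 2) ∂μ = ∑ i ∈ s, ∫⁻ x, g i x * A i x ∂μ := by
          rw [← lintegral_sum_mul (fun i hi => (hgm i hi).aemeasurable)
            fun i hi => (hAm i hi).aemeasurable]
          exact lintegral_congr fun x => by rw [hpair]; simp only [mul_comm]
      _ = ∑ i ∈ s, ∫⁻ x, f i x * avgOn μ (Q i) (g i) x ∂μ :=
          Finset.sum_congr rfl fun i hi =>
            lintegral_mul_avgOn_comm (hQ i hi) (hgm i hi).aemeasurable (hf i hi)
      _ = ∫⁻ x, ∑ i ∈ s, f i x * avgOn μ (Q i) (g i) x ∂μ :=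
          (lintegral_sum_mul hf fun i hi => (measurable_avgOn (hQ i hi) _).aemeasurable).symm
      _ ≤ _ := by
          refine lintegral_mono fun x => ?_
          simpa only [ENNReal.rpow_two] using ENNReal.inner_le_Lp_mul_Lq s (fun i => f i x)
            (fun i => avgOn μ (Q i) (g i) x) Real.HolderConjugate.two_two
      _ ≤ _ := hholder
      _ ≤ Y ^ (1 / p) * (K * ∫⁻ x, U x ^ (p / 2) ∂μ) ^ (1 / p') := by
          gcongr
          exact hc.symm.one_div_nonneg
      _ = _ := by
          rw [ENNReal.mul_rpow_of_nonneg _ _ hc.symm.one_div_nonneg, ← h3, mul_assoc]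
  have h5 := ENNReal.rpow_le_of_le_mul_rpow_one_sub hXfin (by positivity) hX
  have h6 := ENNReal.rpow_le_rpow h5 hp0.le
  rw [ENNReal.mul_rpow_of_nonneg _ _ hp0.le, ← ENNReal.rpow_mul, ← ENNReal.rpow_mul,
    one_div_mul_cancel hp0.ne', ENNReal.rpow_one, ENNReal.rpow_one] at h6
  rwa [mul_comm]

end SquareFunction

/-- Monotone convergence for square functions: bounds for all finite subfamilies pass to the
whole family. -/
lemma lintegral_tsum_rpow_le_of_finset [Countable ι] {a b : ι → α → ℝ≥0∞} {K : ℝ≥0∞} {r : ℝ}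
    (hr : 0 < r) (ha : ∀ i, AEMeasurable (a i) μ)
    (h : ∀ s : Finset ι, ∫⁻ x, (∑ i ∈ s, a i x) ^ r ∂μ ≤ K * ∫⁻ x, (∑ i ∈ s, b i x) ^ r ∂μ) :
    ∫⁻ x, (∑' i, a i x) ^ r ∂μ ≤ K * ∫⁻ x, (∑' i, b i x) ^ r ∂μ := by
  have hsup : ∀ x, (∑' i, a i x) ^ r = ⨆ s : Finset ι, (∑ i ∈ s, a i x) ^ r := fun x => by
    rw [ENNReal.tsum_eq_iSup_sum]
    exact (ENNReal.orderIsoRpow r hr).map_iSup _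
  simp only [hsup]
  rw [lintegral_iSup_directed
    (fun s => (Finset.aemeasurable_fun_sum _ fun i _ => ha i).pow_const r)]
  · refine iSup_le fun s => (h s).trans ?_
    gcongr with x
    exact ENNReal.sum_le_tsum s
  · refine Monotone.directed_le fun s t hst x => ENNReal.rpow_le_rpow ?_ hr.le
    exact Finset.sum_le_sum_of_subset hst

end Maximal

/-- Stein's inequality for a countable laminar family, with a constant depending only on `p`. -/
lemma exists_stein_const (p : ℝ) (hp : 1 < p) : ∃ K : ℝ≥0∞, K ≠ ∞ ∧
    ∀ (α ι : Type) [MeasurableSpace α] [Countable ι] (μ : Measure α) (Q : ι → Set α)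
      (f : ι → α → ℝ≥0∞), (∀ i, MeasurableSet (Q i)) → (∀ i, μ (Q i) ≠ ∞) →
      (∀ i j, Q i ⊆ Q j ∨ Q j ⊆ Q i ∨ Disjoint (Q i) (Q j)) →
      (∀ i, AEMeasurable (f i) μ) → (∀ i, ⨍⁻ y in Q i, f i y ∂μ ≠ ∞) →
      ∫⁻ x, (∑' i, avgOn μ (Q i) (f i) x ^ 2) ^ (p / 2) ∂μ ≤
        K * ∫⁻ x, (∑' i, f i x ^ 2) ^ (p / 2) ∂μ := by
  rcases lt_trichotomy p 2 with h2 | rfl | h2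
  · have hc := Real.HolderConjugate.conjExponent hp
    have hc2 : 1 < p.conjExponent / 2 := by
      have h1 := hc.inv_add_inv_eq_one
      have h3 : (2 : ℝ)⁻¹ < p⁻¹ := inv_strictAnti₀ (by linarith) h2
      have h4 : (p.conjExponent)⁻¹ < (2 : ℝ)⁻¹ := by linarith
      have := (inv_lt_inv₀ hc.symm.pos two_pos).1 h4
      linarith
    refine ⟨(steinConstLarge (p.conjExponent / 2) ^ (1 / p.conjExponent)) ^ p,
      ENNReal.rpow_ne_top_of_nonneg (by linarith) (ENNReal.rpow_ne_top_of_nonneg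
        hc.symm.one_div_nonneg (steinConstLarge_ne_top hc2)), ?_⟩
    intro α ι _ _ μ Q f hQ hfin hlam hf hffin
    refine lintegral_tsum_rpow_le_of_finset (by linarith)
      (fun i => ((measurable_avgOn (hQ i) _).pow_const 2).aemeasurable) fun s => ?_
    refine lintegral_sum_avgOn_sq_rpow_le_of_conj hc (fun i _ => hQ i) (fun i _ => hfin i) ?_
      (fun i _ => hf i) (fun i _ => hffin i)
    intro g hg hgfin
    exact lintegral_sum_avgOn_sq_rpow_le hc2 (fun i _ => hQ i) (fun i _ => hfin i)
      (fun i _ j _ => hlam i j) (fun i hi => (hg i hi).aemeasurable) hgfin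
  · refine ⟨1, by simp, ?_⟩
    intro α ι _ _ μ Q f hQ hfin hlam hf hffin
    refine lintegral_tsum_rpow_le_of_finset (by norm_num)
      (fun i => ((measurable_avgOn (hQ i) _).pow_const 2).aemeasurable) fun s => ?_
    simpa using lintegral_sum_avgOn_sq_le (s := s) (fun i _ => hQ i) (fun i _ => hfin i)
      (fun i _ => hf i)
  · have hp2 : 1 < p / 2 := by linarith
    refine ⟨steinConstLarge (p / 2), steinConstLarge_ne_top hp2, ?_⟩
    intro α ι _ _ μ Q f hQ hfin hlam hf hffin
    refine lintegral_tsum_rpow_le_of_finset (by linarith)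
      (fun i => ((measurable_avgOn (hQ i) _).pow_const 2).aemeasurable) fun s => ?_
    exact lintegral_sum_avgOn_sq_rpow_le hp2 (fun i _ => hQ i) (fun i _ => hfin i)
      (fun i _ j _ => hlam i j) (fun i _ => hf i) (fun i _ => hffin i)

section Dyadic

variable {N : ℕ}

lemma dyCube_eq_pi (k : ℤ) (x : EucN N) :
    dyCube N k x = univ.pi fun i => Ico (x i) (x i + (2 : ℝ) ^ (-k)) := by
  ext y; simp [dyCube]

lemma measurableSet_dyCube (k : ℤ) (x : EucN N) : MeasurableSet (dyCube N k x) := by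
  rw [dyCube_eq_pi]
  exact MeasurableSet.univ_pi fun _ => measurableSet_Ico

lemma dyCube_subset_Icc (k : ℤ) (x : EucN N) :
    dyCube N k x ⊆ Icc x fun i => x i + (2 : ℝ) ^ (-k) :=
  fun _ hy => ⟨fun i => (hy i).1, fun i => (hy i).2.le⟩

lemma interior_dyCube_nonempty (k : ℤ) (x : EucN N) : (interior (dyCube N k x)).Nonempty := by
  rw [dyCube_eq_pi, interior_pi_set finite_univ]
  simp only [interior_Ico, univ_pi_nonempty_iff, nonempty_Ioo]
  intro i
  have : (0 : ℝ) < 2 ^ (-k) := by positivity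
  linarith

namespace DyadicLattice

lemma exists_eq_dyCube (D : DyadicLattice N) {Q : Set (EucN N)} (hQ : Q ∈ D.cubes) :
    ∃ k x, Q = dyCube N k x := by
  obtain ⟨k, hk⟩ := mem_iUnion.1 hQ
  exact ⟨k, D.cube_form k Q hk⟩

lemma measurableSet_cube (D : DyadicLattice N) {Q : Set (EucN N)} (hQ : Q ∈ D.cubes) :
    MeasurableSet Q := by
  obtain ⟨k, x, rfl⟩ := D.exists_eq_dyCube hQ
  exact measurableSet_dyCube k x

lemma exists_isCompact_superset (D : DyadicLattice N) {Q : Set (EucN N)} (hQ : Q ∈ D.cubes) :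
    ∃ K, IsCompact K ∧ Q ⊆ K := by
  obtain ⟨k, x, rfl⟩ := D.exists_eq_dyCube hQ
  exact ⟨_, isCompact_Icc, dyCube_subset_Icc k x⟩

lemma measure_cube_ne_top (D : DyadicLattice N) (σ : Measure (EucN N))
    [IsLocallyFiniteMeasure σ] {Q : Set (EucN N)} (hQ : Q ∈ D.cubes) : σ Q ≠ ∞ := by
  obtain ⟨K, hK, hQK⟩ := D.exists_isCompact_superset hQ
  exact ne_top_of_le_ne_top hK.measure_ne_top (measure_mono hQK)

lemma countable_cubes (D : DyadicLattice N) : D.cubes.Countable := by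
  refine countable_iUnion fun k => (D.pairwiseDisjoint k).countable_of_nonempty_interior ?_
  intro Q hQ
  obtain ⟨x, rfl⟩ := D.cube_form k Q hQ
  exact interior_dyCube_nonempty k x

lemma exists_superset_gen (D : DyadicLattice N) {k : ℤ} {Q : Set (EucN N)} (n : ℕ)
    (hQ : Q ∈ D.gen (k + n)) : ∃ R ∈ D.gen k, Q ⊆ R := by
  induction n generalizing Q with
  | zero => exact ⟨Q, by simpa using hQ, Subset.rfl⟩
  | succ n ih =>
    obtain ⟨R, hR, hQR⟩ := D.nested (k + n) Q (by rwa [add_assoc, ← Nat.cast_succ])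
    obtain ⟨S, hS, hRS⟩ := ih hR
    exact ⟨S, hS, hQR.trans hRS⟩

lemma subset_or_disjoint_of_le (D : DyadicLattice N) {k l : ℤ} (hkl : k ≤ l)
    {Q R : Set (EucN N)} (hQ : Q ∈ D.gen k) (hR : R ∈ D.gen l) : R ⊆ Q ∨ Disjoint Q R := by
  obtain ⟨n, rfl⟩ := Int.le.dest hkl
  obtain ⟨S, hS, hRS⟩ := D.exists_superset_gen n hR
  by_cases h : Q = S
  · exact Or.inl (h ▸ hRS)
  · exact Or.inr ((D.pairwiseDisjoint k hQ hS h).mono_right hRS)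

lemma laminar (D : DyadicLattice N) {Q R : Set (EucN N)} (hQ : Q ∈ D.cubes) (hR : R ∈ D.cubes) :
    Q ⊆ R ∨ R ⊆ Q ∨ Disjoint Q R := by
  obtain ⟨k, hk⟩ := mem_iUnion.1 hQ
  obtain ⟨l, hl⟩ := mem_iUnion.1 hR
  rcases le_total k l with h | h
  · exact Or.inr (D.subset_or_disjoint_of_le h hk hl)
  · exact (D.subset_or_disjoint_of_le h hl hk).imp_right fun h => Or.inr h.symm

end DyadicLattice

lemma indE_of_mem {Q : Set (EucN N)} {x : EucN N} (hx : x ∈ Q) : indE Q x = 1 :=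
  indicator_of_mem hx _

lemma indE_of_notMem {Q : Set (EucN N)} {x : EucN N} (hx : x ∉ Q) : indE Q x = 0 :=
  indicator_of_notMem hx _

lemma measurable_indE {Q : Set (EucN N)} (hQ : MeasurableSet Q) : Measurable (indE Q) :=
  measurable_one.indicator hQ

lemma sqNorm_mono {ι : Type*} {μ : Measure (EucN N)} {p : ℝ} (hp : 0 ≤ p)
    {f g : ι → EucN N → ℝ≥0∞} (h : ∀ i x, f i x ≤ g i x) : sqNorm μ p f ≤ sqNorm μ p g := by
  unfold sqNorm
  gcongr with x i
  exact h i x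

lemma sqA_le_steinC (D : DyadicLattice N) (σ w : Measure (EucN N)) [IsLocallyFiniteMeasure σ]
    (p q : ℝ) : sqA D σ w p q ≤ steinC D σ w p q := by
  refine sInf_le_sInf fun C hC a => ?_
  convert hC (fun Q _ => a Q) fun Q _ => locallyIntegrable_const (a Q) using 1
  congr! 5 with Q x
  rw [setIntegral_const, smul_eq_mul, abs_mul, ENNReal.ofReal_mul (abs_nonneg _), mul_comm,
    Measure.real, abs_of_nonneg ENNReal.toReal_nonneg,
    ENNReal.ofReal_toReal (D.measure_cube_ne_top σ Q.2), ← Real.norm_eq_abs, ofReal_norm]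
  rfl

/-- The `σ`-average of `f` over `Q`, in absolute value. -/
def absAvg (σ : Measure (EucN N)) (f : Set (EucN N) → EucN N → ℝ) (Q : Set (EucN N)) : ℝ :=
  |∫ y in Q, f Q y ∂σ| / (σ Q).toReal

lemma nnnorm_absAvg_mul {σ : Measure (EucN N)} (f : Set (EucN N) → EucN N → ℝ)
    {Q : Set (EucN N)} (hQ : σ Q ≠ ∞) :
    (‖absAvg σ f Q‖₊ : ℝ≥0∞) * σ Q = ENNReal.ofReal |∫ y in Q, f Q y ∂σ| := by
  have h0 : 0 ≤ absAvg σ f Q := by unfold absAvg; positivity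
  rw [← enorm_eq_nnnorm, Real.enorm_of_nonneg h0]
  rcases eq_or_ne (σ Q) 0 with hz | hz
  · simp [hz, Measure.restrict_eq_zero.2 hz]
  · conv_lhs => rw [← ENNReal.ofReal_toReal hQ]
    rw [← ENNReal.ofReal_mul h0, absAvg, div_mul_cancel₀ _ (ENNReal.toReal_ne_zero.2 ⟨hz, hQ⟩)]

/-- Stein's inequality for the dyadic averages of a family of locally integrable functions. -/
lemma exists_sqNorm_absAvg_le (p : ℝ) (hp : 1 < p) : ∃ C : ℝ≥0∞, C ≠ ∞ ∧
    ∀ {N : ℕ} (D : DyadicLattice N) (σ : Measure (EucN N)) [IsLocallyFiniteMeasure σ]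
      (f : Set (EucN N) → EucN N → ℝ), (∀ Q ∈ D.cubes, LocallyIntegrable (f Q) σ) →
      sqNorm σ p (fun Q : D.cubes => fun x =>
        (‖absAvg σ f (Q : Set (EucN N))‖₊ : ℝ≥0∞) * indE (Q : Set (EucN N)) x) ≤
      C * sqNorm σ p (fun Q : D.cubes => fun x =>
        (‖f (Q : Set (EucN N)) x‖₊ : ℝ≥0∞) * indE (Q : Set (EucN N)) x) := by
  obtain ⟨K, hK, hstein⟩ := exists_stein_const p hp
  have hp0 : 0 < p := by linarith
  refine ⟨K ^ (1 / p), ENNReal.rpow_ne_top_of_nonneg (by positivity) hK, ?_⟩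
  intro N D σ _ f hf
  have : Countable D.cubes := D.countable_cubes
  let F : D.cubes → EucN N → ℝ≥0∞ := fun Q x => (‖f (Q : Set (EucN N)) x‖₊ : ℝ≥0∞) * indE Q x
  have hQm : ∀ Q : D.cubes, MeasurableSet (Q : Set (EucN N)) := fun Q => D.measurableSet_cube Q.2
  have hFint : ∀ Q : D.cubes, ∫⁻ x in Q, F Q x ∂σ = ∫⁻ x in Q, ‖f Q x‖ₑ ∂σ := fun Q =>
    setLIntegral_congr_fun (hQm Q) fun x hx => by simp [F, indE_of_mem hx, enorm_eq_nnnorm]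
  have hF := hstein (EucN N) D.cubes σ (fun Q => (Q : Set (EucN N))) F hQm
    (fun Q => D.measure_cube_ne_top σ Q.2) (fun Q R => D.laminar Q.2 R.2)
    (fun Q => (hf Q Q.2).aestronglyMeasurable.enorm.mul (measurable_indE (hQm Q)).aemeasurable)
    (fun Q => by
      rw [setLAverage_eq, hFint]
      rcases eq_or_ne (σ Q) 0 with hz | hz
      · simp [Measure.restrict_eq_zero.2 hz]
      · obtain ⟨L, hL, hQL⟩ := D.exists_isCompact_superset Q.2
        exact ENNReal.div_ne_top
          (((hf Q Q.2).integrableOn_isCompact hL).mono_set hQL).2.ne hz)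
  have hle : ∀ (Q : D.cubes) x, (‖absAvg σ f (Q : Set (EucN N))‖₊ : ℝ≥0∞) *
      indE (Q : Set (EucN N)) x ≤ avgOn σ (Q : Set (EucN N)) (F Q) x := by
    intro Q x
    by_cases hx : x ∈ (Q : Set (EucN N))
    swap
    · simp [indE_of_notMem hx]
    rw [indE_of_mem hx, mul_one, avgOn_of_mem hx, setLAverage_eq, hFint]
    rcases eq_or_ne (σ Q) 0 with hz | hz
    · simp [absAvg, hz]
    · rw [ENNReal.le_div_iff_mul_le (Or.inl hz) (Or.inl (D.measure_cube_ne_top σ Q.2)),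
        nnnorm_absAvg_mul f (D.measure_cube_ne_top σ Q.2), ← Real.norm_eq_abs, ofReal_norm]
      exact enorm_integral_le_lintegral_enorm _
  refine (sqNorm_mono hp0.le hle).trans ?_
  unfold sqNorm
  rw [← ENNReal.mul_rpow_of_nonneg _ _ (by positivity)]
  exact ENNReal.rpow_le_rpow hF (by positivity)

end Dyadic

/-- The best constant in the two-weight Stein inequality is comparable to
the quadratic `𝒜_{p,q}` constant: `[σ,w]_{p,q} ≤ 𝒮(σ,w,p,q) ≤ C(p,N)·[σ,w]_{p,q}`, where
the constant depends only on `p` and `N`. -/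
theorem stein_comparable_quadratic_Apq (p : ℝ) (N : ℕ) (hp : 1 < p) (hN : 1 ≤ N) :
    ∃ C : ℝ≥0∞, C ≠ ∞ ∧
      ∀ q : ℝ, 1 < q →
        ∀ (D : DyadicLattice N) (σ w : Measure (EucN N)),
          IsLocallyFiniteMeasure σ → IsLocallyFiniteMeasure w →
          sqA D σ w p q ≤ steinC D σ w p q ∧ steinC D σ w p q ≤ C * sqA D σ w p q := by
  obtain ⟨C, hC, hstein⟩ := exists_sqNorm_absAvg_le p hp
  refine ⟨C + 1, by simp [hC], ?_⟩
  intro q _ D σ w hσ _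
  refine ⟨sqA_le_steinC D σ w p q, ?_⟩
  rw [sqA, sInf_eq_iInf', ENNReal.mul_iInf_of_ne (by simp) (by simp [hC])]
  refine le_iInf fun ⟨A, hA⟩ => sInf_le fun f hf => ?_
  have h := hA (absAvg σ f)
  simp only [fun Q : D.cubes => nnnorm_absAvg_mul f (D.measure_cube_ne_top σ Q.2)] at h
  refine h.trans ?_
  rw [mul_comm (C + 1), mul_assoc]
  gcongr
  exact (hstein D σ f hf).trans (by gcongr; exact le_self_add)

end
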